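/- arXiv:2105.00359 — 7 statements merged into one kernel-verified Lean document; each statement's English description precedes it below -/
import Mathlib

section
/- Let A ⊆ ℝ² be any subset with 0 ∈ cl(A). Then the operation GD is stabilised at degree 3 for A, i.e. GD³(A) = GD^m(A) for every integer m ≥ 3 (equivalently, GD³(A) = GD⁴(A) = GD⁵(A) = ⋯). -/
open Filter Topology Metric Set

/-- The direction set `D_p(A)` of `A ⊆ ℝⁿ` at `p`: unit vectors `a` for which there is a
sequence in `A \ {p}` converging to `p` whose normalised secants converge to `a`. -/
def dirSet {n : ℕ} (A : Set (EuclideanSpace ℝ (Fin n))) (p : EuclideanSpace ℝ (Fin n)) :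
    Set (EuclideanSpace ℝ (Fin n)) :=
  {a | ‖a‖ = 1 ∧ ∃ x : ℕ → EuclideanSpace ℝ (Fin n),
    (∀ i, x i ∈ A ∧ x i ≠ p) ∧
    Tendsto x atTop (nhds p) ∧
    Tendsto (fun i => (‖x i - p‖)⁻¹ • (x i - p)) atTop (nhds a)}

/-- `D_A(A) = {(p, a) : p ∈ A, a ∈ D_p(A)} ⊆ ℝⁿ × ℝⁿ`. -/
def dirBundle {n : ℕ} (A : Set (EuclideanSpace ℝ (Fin n))) :
    Set (EuclideanSpace ℝ (Fin n) × EuclideanSpace ℝ (Fin n)) :=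
  {pa | pa.1 ∈ A ∧ pa.2 ∈ dirSet A pa.1}

/-- The geometric directional bundle of `A` at `0`:
`GD(A) = {a ∈ S^{n-1} : (0, a) ∈ cl(D_A(A))}`. -/
def GD {n : ℕ} (A : Set (EuclideanSpace ℝ (Fin n))) : Set (EuclideanSpace ℝ (Fin n)) :=
  {a | ((0 : EuclideanSpace ℝ (Fin n)), a) ∈ closure (dirBundle A)}

/-- The half-cone `LGD(A) = {t a : t ≥ 0, a ∈ GD(A)}`. -/
def LGD {n : ℕ} (A : Set (EuclideanSpace ℝ (Fin n))) : Set (EuclideanSpace ℝ (Fin n)) :=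
  {x | ∃ t : ℝ, 0 ≤ t ∧ ∃ a ∈ GD A, x = t • a}

theorem mem_dirSet_of_frequently {n : ℕ} {A : Set (EuclideanSpace ℝ (Fin n))}
    {p u : EuclideanSpace ℝ (Fin n)} (hu : ‖u‖ = 1)
    (h : ∃ᶠ s : ℝ in 𝓝[>] 0, p + s • u ∈ A) : u ∈ dirSet A p := by
  obtain ⟨s, hs, hsA⟩ :=
    exists_seq_forall_of_frequently (h.and_eventually self_mem_nhdsWithin)
  have hpos : ∀ i, 0 < s i := fun i => (hsA i).2
  have hu0 : u ≠ 0 := by rintro rfl; simp at hu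
  refine ⟨hu, fun i => p + s i • u, fun i => ⟨(hsA i).1, ?_⟩, ?_, ?_⟩
  · simp [hu0, (hpos i).ne']
  · have hs0 : Tendsto s atTop (𝓝 0) := hs.mono_right nhdsWithin_le_nhds
    simpa using (hs0.smul_const u).const_add p
  · refine tendsto_const_nhds.congr fun i => ?_
    simp [norm_smul, hu, abs_of_pos (hpos i), smul_smul, (hpos i).ne']

theorem norm_eq_one_of_mem_GD {n : ℕ} {A : Set (EuclideanSpace ℝ (Fin n))}
    {a : EuclideanSpace ℝ (Fin n)} (ha : a ∈ GD A) : ‖a‖ = 1 := by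
  have hcl : IsClosed {q : EuclideanSpace ℝ (Fin n) × EuclideanSpace ℝ (Fin n) | ‖q.2‖ = 1} :=
    isClosed_eq (by fun_prop) continuous_const
  have hsub : dirBundle A ⊆ {q | ‖q.2‖ = 1} := by
    rintro ⟨p, u⟩ ⟨-, hu, -⟩
    exact hu
  have h : ((0 : EuclideanSpace ℝ (Fin n)), a) ∈ {q : EuclideanSpace ℝ (Fin n) ×
      EuclideanSpace ℝ (Fin n) | ‖q.2‖ = 1} := closure_minimal hsub hcl ha
  rwa [mem_ofPred_eq] at h

theorem isClosed_GD {n : ℕ} (A : Set (EuclideanSpace ℝ (Fin n))) : IsClosed (GD A) :=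
  isClosed_closure.preimage (by fun_prop : Continuous
    fun a : EuclideanSpace ℝ (Fin n) => ((0 : EuclideanSpace ℝ (Fin n)), a))

theorem smul_mem_LGD {n : ℕ} {A : Set (EuclideanSpace ℝ (Fin n))}
    {x : EuclideanSpace ℝ (Fin n)} (hx : x ∈ LGD A) {t : ℝ} (ht : 0 ≤ t) : t • x ∈ LGD A := by
  obtain ⟨r, hr, a, ha, rfl⟩ := hx
  exact ⟨t * r, mul_nonneg ht hr, a, ha, smul_smul _ _ _⟩

theorem GD_subset_LGD {n : ℕ} (A : Set (EuclideanSpace ℝ (Fin n))) : GD A ⊆ LGD A :=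
  fun a ha => ⟨1, zero_le_one, a, ha, (one_smul ℝ a).symm⟩

theorem LGD_congr {n : ℕ} {A B : Set (EuclideanSpace ℝ (Fin n))} (h : GD A = GD B) :
    LGD A = LGD B := by
  simp only [LGD, h]

/-- On a cone, directions at any of its points are seen arbitrarily close to the origin. -/
theorem mem_GD_LGD_of_frequently {n : ℕ} {A : Set (EuclideanSpace ℝ (Fin n))}
    {p u : EuclideanSpace ℝ (Fin n)} (hp : p ∈ LGD A) (hu : ‖u‖ = 1)
    (h : ∃ᶠ s : ℝ in 𝓝[>] 0, p + s • u ∈ LGD A) : u ∈ GD (LGD A) := by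
  have hmem : ∀ t : ℝ, 0 < t → (t • p, u) ∈ dirBundle (LGD A) := by
    refine fun t ht => ⟨smul_mem_LGD hp ht.le, mem_dirSet_of_frequently hu ?_⟩
    have htend : Tendsto (fun s : ℝ => t * s) (𝓝[>] 0) (𝓝[>] 0) := by
      refine tendsto_nhdsWithin_of_tendsto_nhds_of_eventually_within _ ?_ ?_
      · have : Tendsto (fun s : ℝ => t * s) (𝓝 0) (𝓝 (t * 0)) :=
          (continuous_const_mul t).tendsto 0
        rw [mul_zero] at this
        exact this.mono_left nhdsWithin_le_nhds
      · filter_upwards [self_mem_nhdsWithin] with s hs using mul_pos ht hs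
    refine htend.frequently (h.mono fun s hs => ?_)
    simpa [smul_smul] using smul_mem_LGD hs ht.le
  have hlim : Tendsto (fun t : ℝ => (t • p, u)) (𝓝[>] 0) (𝓝 (0, u)) := by
    have hc : Continuous fun t : ℝ => (t • p, u) := by fun_prop
    have := hc.tendsto 0
    rw [zero_smul] at this
    exact this.mono_left nhdsWithin_le_nhds
  exact mem_closure_of_tendsto hlim (by filter_upwards [self_mem_nhdsWithin] using hmem)

theorem GD_LGD_of_finite {n : ℕ} {A : Set (EuclideanSpace ℝ (Fin n))} (hA : (GD A).Finite) :
    GD (LGD A) = GD A ∪ -GD A := by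
  have hfin : (GD A ∪ -GD A).Finite := hA.union hA.neg
  apply Subset.antisymm
  · have hcl : IsClosed {q : EuclideanSpace ℝ (Fin n) × EuclideanSpace ℝ (Fin n) |
        q.2 ∈ GD A ∪ -GD A} := hfin.isClosed.preimage continuous_snd
    refine fun a ha => closure_minimal ?_ hcl ha
    rintro ⟨p, u⟩ ⟨-, -, x, hxA, hxp, hxu⟩
    obtain ⟨c, hc, hfreq⟩ : ∃ c ∈ GD A, ∃ᶠ i in atTop, ∃ t : ℝ, 0 ≤ t ∧ x i = t • c := by
      by_contra! hcon
      obtain ⟨i, hi⟩ := ((eventually_all_finite hA).2 hcon).exists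
      obtain ⟨t, ht, c, hc, hx⟩ := (hxA i).1
      exact hi c hc t ht hx
    have hc1 := norm_eq_one_of_mem_GD hc
    have hpc : p ∈ Submodule.span ℝ {c} :=
      (Submodule.closed_of_finiteDimensional (Submodule.span ℝ {c})).mem_of_frequently_of_tendsto
        (hfreq.mono fun i ⟨t, _, ht⟩ => Submodule.mem_span_singleton.2 ⟨t, ht.symm⟩) hxp
    obtain ⟨r, rfl⟩ := Submodule.mem_span_singleton.1 hpc
    refine hfin.isClosed.mem_of_frequently_of_tendsto (hfreq.mono ?_) hxu
    rintro i ⟨t, -, ht⟩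
    have hne : t - r ≠ 0 := by
      intro h0
      exact (hxA i).2 (by rw [ht, sub_eq_zero.1 h0])
    simp only [ht, ← sub_smul, norm_smul, hc1, mul_one, Real.norm_eq_abs, smul_smul]
    rcases hne.lt_or_gt with h | h
    · right
      rw [abs_of_neg h, inv_neg, neg_mul, inv_mul_cancel₀ hne]
      simpa using hc
    · left
      rw [abs_of_pos h, inv_mul_cancel₀ hne]
      simpa using hc
  · have hsmall : ∀ᶠ s : ℝ in 𝓝[>] 0, 0 < s ∧ s < 1 := by
      filter_upwards [Ioo_mem_nhdsGT (zero_lt_one' ℝ)] with s hs using hs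
    rintro a (ha | ha)
    · have ha1 := norm_eq_one_of_mem_GD ha
      refine mem_GD_LGD_of_frequently (GD_subset_LGD A ha) ha1
        (hsmall.mono fun s hs => ⟨1 + s, by linarith, a, ha, ?_⟩).frequently
      rw [add_smul, one_smul]
    · have ha1 := norm_eq_one_of_mem_GD ha
      refine mem_GD_LGD_of_frequently (GD_subset_LGD A ha) (by simpa using ha1)
        (hsmall.mono fun s hs => ⟨1 - s, by linarith, -a, ha, ?_⟩).frequently
      rw [sub_smul, one_smul, smul_neg, sub_neg_eq_add]

theorem mem_GD_LGD_of_mem_interior {n : ℕ} {A : Set (EuclideanSpace ℝ (Fin n))}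
    {b u : EuclideanSpace ℝ (Fin n)} (hb : b ∈ interior (LGD A)) (hu : ‖u‖ = 1) :
    u ∈ GD (LGD A) := by
  refine mem_GD_LGD_of_frequently (interior_subset hb) hu (Eventually.frequently ?_)
  have hc : Continuous fun s : ℝ => b + s • u := by fun_prop
  have h := hc.tendsto 0
  rw [zero_smul, add_zero] at h
  exact (h.mono_left nhdsWithin_le_nhds).eventually (mem_interior_iff_mem_nhds.1 hb)

/-- The planar cross product. -/
def cross (x y : EuclideanSpace ℝ (Fin 2)) : ℝ := x 0 * y 1 - x 1 * y 0

theorem continuous_cross : Continuous fun q : EuclideanSpace ℝ (Fin 2) × EuclideanSpace ℝ (Fin 2) =>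
    cross q.1 q.2 := by
  unfold cross
  fun_prop

theorem norm_eq_one_iff_coord (x : EuclideanSpace ℝ (Fin 2)) :
    ‖x‖ = 1 ↔ x 0 ^ 2 + x 1 ^ 2 = 1 := by
  rw [← sq_eq_sq₀ (norm_nonneg x) zero_le_one, EuclideanSpace.real_norm_sq_eq, Fin.sum_univ_two,
    one_pow]

/-- If rays of a cone accumulate at `p` from one side, then every direction pointing to that side
belongs to the bundle of the cone. -/
theorem mem_GD_LGD_of_cross_pos {A : Set (EuclideanSpace ℝ (Fin 2))}
    {p u : EuclideanSpace ℝ (Fin 2)} {σ : ℝ} (hp : p ∈ LGD A)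
    (h : ∃ᶠ y in 𝓝 p, y ∈ LGD A ∧ 0 < σ * cross p y) (hu : ‖u‖ = 1)
    (hpu : 0 < σ * cross p u) : u ∈ GD (LGD A) := by
  have hpu0 : cross p u ≠ 0 := right_ne_zero_of_mul hpu.ne'
  have hcp : Continuous fun y => cross p y :=
    continuous_cross.comp (by fun_prop : Continuous fun y => (p, y))
  have hcu : Continuous fun y => cross y u :=
    continuous_cross.comp (by fun_prop : Continuous fun y => (y, u))
  have hlim : Tendsto (fun y => cross p y / cross y u) (𝓝 p) (𝓝 0) := by
    have h := (hcp.tendsto p).div (hcu.tendsto p) hpu0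
    rwa [show cross p p = 0 by unfold cross; ring, zero_div] at h
  have hnear : ∀ᶠ y in 𝓝 p, 0 < σ * cross y u :=
    (hcu.const_mul σ).tendsto p |>.eventually_const_lt hpu
  refine mem_GD_LGD_of_frequently hp hu (frequently_nhdsWithin_iff.2 ?_)
  refine hlim.frequently ((h.and_eventually hnear).mono ?_)
  rintro y ⟨⟨hy, hpy⟩, hyu⟩
  have hyu0 : cross y u ≠ 0 := right_ne_zero_of_mul hyu.ne'
  have hσ : σ ≠ 0 := left_ne_zero_of_mul hyu.ne'
  have hratio : ∀ c : ℝ, 0 < σ * c → 0 < c / cross y u := fun c hc => by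
    rw [← mul_div_mul_left _ _ hσ]
    exact div_pos hc hyu
  refine ⟨?_, hratio _ hpy⟩
  convert smul_mem_LGD hy (hratio _ hpu).le using 1
  ext i
  fin_cases i <;> simp <;> field_simp <;> unfold cross <;> ring

theorem cross_ne_zero_of_unit {x y : EuclideanSpace ℝ (Fin 2)} (hx : ‖x‖ = 1) (hy : ‖y‖ = 1)
    (hxy : x ≠ y) (hpos : 0 < x 0 * y 0 + x 1 * y 1) : cross x y ≠ 0 := by
  rw [norm_eq_one_iff_coord] at hx hy
  intro h
  unfold cross at h
  have hinner : x 0 * y 0 + x 1 * y 1 = 1 := by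
    have : (x 0 * y 0 + x 1 * y 1) ^ 2 = 1 := by
      linear_combination (y 0 ^ 2 + y 1 ^ 2) * hx + hy - (x 0 * y 1 - x 1 * y 0) * h
    nlinarith
  apply hxy
  ext i
  fin_cases i
  · show x 0 = y 0
    linear_combination x 1 * h - x 0 * hinner + y 0 * hx
  · show x 1 = y 1
    linear_combination -x 0 * h - x 1 * hinner + y 1 * hx

theorem interior_LGD_LGD_nonempty {A : Set (EuclideanSpace ℝ (Fin 2))} (hA : (GD A).Infinite) :
    (interior (LGD (LGD A))).Nonempty := by
  have hsub : GD A ⊆ sphere (0 : EuclideanSpace ℝ (Fin 2)) 1 := fun a ha => by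
    simpa using norm_eq_one_of_mem_GD ha
  obtain ⟨a, -, hacc⟩ :=
    hA.exists_accPt_of_subset_isCompact (isCompact_sphere _ _) hsub
  have haG : a ∈ GD A := (isClosed_GD A).closure_subset
    (mem_closure_iff_clusterPt.2 hacc.clusterPt)
  have ha := norm_eq_one_of_mem_GD haG
  have ha2 := (norm_eq_one_iff_coord a).1 ha
  have hnear : ∀ᶠ y in 𝓝 a, 0 < a 0 * y 0 + a 1 * y 1 := by
    have hc : Continuous fun y : EuclideanSpace ℝ (Fin 2) => a 0 * y 0 + a 1 * y 1 := by fun_prop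
    exact (hc.tendsto a).eventually_const_lt (by nlinarith)
  have hfreq : ∃ᶠ y in 𝓝 a, (y ∈ LGD A ∧ 0 < 1 * cross a y) ∨
      (y ∈ LGD A ∧ 0 < -1 * cross a y) := by
    refine ((accPt_iff_frequently.1 hacc).and_eventually hnear).mono ?_
    rintro y ⟨⟨hne, hy⟩, hpos⟩
    have hcross := cross_ne_zero_of_unit ha (norm_eq_one_of_mem_GD hy) hne.symm hpos
    rcases hcross.lt_or_gt with h | h
    · exact Or.inr ⟨GD_subset_LGD A hy, by linarith⟩
    · exact Or.inl ⟨GD_subset_LGD A hy, by linarith⟩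
  obtain ⟨σ, hσ, hside⟩ : ∃ σ : ℝ, σ ≠ 0 ∧ ∃ᶠ y in 𝓝 a, y ∈ LGD A ∧ 0 < σ * cross a y := by
    rcases frequently_or_distrib.1 hfreq with h | h
    · exact ⟨1, by norm_num, h⟩
    · exact ⟨-1, by norm_num, h⟩
  have hhalf : {x | 0 < σ * cross a x} ⊆ LGD (LGD A) := by
    intro x hx
    have hx0 : x ≠ 0 := by
      rintro rfl
      simp [cross] at hx
    have hnx : 0 < ‖x‖ := norm_pos_iff.2 hx0
    refine ⟨‖x‖, hnx.le, ‖x‖⁻¹ • x, ?_, by rw [smul_smul, mul_inv_cancel₀ hnx.ne', one_smul]⟩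
    refine mem_GD_LGD_of_cross_pos (GD_subset_LGD A haG) hside
      (by rw [norm_smul, norm_inv, norm_norm, inv_mul_cancel₀ hnx.ne']) ?_
    have : σ * cross a (‖x‖⁻¹ • x) = ‖x‖⁻¹ * (σ * cross a x) := by
      simp only [cross, PiLp.smul_apply, smul_eq_mul]
      ring
    rw [this]
    exact mul_pos (inv_pos.2 hnx) hx
  have hopen : IsOpen {x | 0 < σ * cross a x} :=
    isOpen_lt continuous_const ((continuous_cross.comp
      (by fun_prop : Continuous fun y => (a, y))).const_mul σ)
  refine ⟨!₂[-(σ * a 1), σ * a 0], interior_maximal hhalf hopen ?_⟩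
  have : σ * cross a !₂[-(σ * a 1), σ * a 0] = σ ^ 2 := by
    simp only [cross, Matrix.cons_val_zero, Matrix.cons_val_one]
    linear_combination σ ^ 2 * ha2
  simp only [mem_ofPred_eq, this]
  positivity

theorem GD_LGD_eq_sphere {n : ℕ} {A : Set (EuclideanSpace ℝ (Fin n))}
    (hA : (interior (LGD A)).Nonempty) :
    GD (LGD A) = sphere (0 : EuclideanSpace ℝ (Fin n)) 1 := by
  obtain ⟨b, hb⟩ := hA
  ext u
  rw [mem_sphere_zero_iff_norm]
  exact ⟨norm_eq_one_of_mem_GD, mem_GD_LGD_of_mem_interior hb⟩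

theorem subset_LGD_of_GD_eq_sphere {n : ℕ} {A B : Set (EuclideanSpace ℝ (Fin n))}
    (hA : GD A = sphere (0 : EuclideanSpace ℝ (Fin n)) 1) : LGD B ⊆ LGD A := by
  rintro _ ⟨t, ht, a, ha, rfl⟩
  exact ⟨t, ht, a, by simpa [hA] using norm_eq_one_of_mem_GD ha, rfl⟩

theorem GD_LGD_iterate_three (A : Set (EuclideanSpace ℝ (Fin 2))) :
    GD (LGD (LGD (LGD A))) = GD (LGD (LGD A)) := by
  by_cases hA : (GD A).Finite
  · have h1 := GD_LGD_of_finite hA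
    have h2 : GD (LGD (LGD A)) = GD (LGD A) := by
      rw [GD_LGD_of_finite (h1 ▸ hA.union hA.neg), h1]
      simp [union_comm]
    rw [LGD_congr h2]
  · have hint := interior_LGD_LGD_nonempty hA
    have h2 := GD_LGD_eq_sphere hint
    rw [h2]
    exact GD_LGD_eq_sphere (hint.mono (interior_mono (subset_LGD_of_GD_eq_sphere h2)))

/-- For any A ⊆ ℝ² with 0 ∈ cl(A), the operation GD is stabilised at degree 3:
GD³(A) = GD^m(A) for every m ≥ 3, where GD^m(A) = GD(LGD^[m-1](A)). -/
theorem stmt_0 (A : Set (EuclideanSpace ℝ (Fin 2)))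
    (h0 : (0 : EuclideanSpace ℝ (Fin 2)) ∈ closure A) :
    ∀ m : ℕ, 3 ≤ m → GD (LGD^[m - 1] A) = GD (LGD^[2] A) := by
  intro m hm
  obtain ⟨k, rfl⟩ := Nat.exists_eq_add_of_le' hm
  cases k with
  | zero => rfl
  | succ k =>
    rw [show k + 1 + 3 - 1 = k + 3 by omega, Function.iterate_add_apply]
    have hfix : LGD^[k] (LGD^[3] A) = LGD^[3] A :=
      Function.iterate_fixed (LGD_congr (GD_LGD_iterate_three A)) k
    rw [hfix]
    exact GD_LGD_iterate_three A
end

section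
/- Let A, B ⊆ ℝⁿ be subsets with 0 ∈ cl(A) and 0 ∈ cl(B). Assume that for every x ∈ ℝⁿ one has {x} × D_x(A) ⊆ cl(D_A(A)) and {x} × D_x(B) ⊆ cl(D_B(B)) (these inclusions hold automatically when A and B are subanalytic). Then GD(A ∪ B) = GD(A) ∪ GD(B). -/
open Filter Topology Metric Set

theorem dirSet_mono {n : ℕ} {A B : Set (EuclideanSpace ℝ (Fin n))} (h : A ⊆ B)
    (p : EuclideanSpace ℝ (Fin n)) : dirSet A p ⊆ dirSet B p := by
  rintro a ⟨ha, x, hx, hxp, hxa⟩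
  exact ⟨ha, x, fun i => ⟨h (hx i).1, (hx i).2⟩, hxp, hxa⟩

theorem dirSet_union {n : ℕ} (A B : Set (EuclideanSpace ℝ (Fin n)))
    (p : EuclideanSpace ℝ (Fin n)) : dirSet (A ∪ B) p = dirSet A p ∪ dirSet B p := by
  refine Subset.antisymm ?_
    (union_subset (dirSet_mono subset_union_left p) (dirSet_mono subset_union_right p))
  rintro a ⟨ha, x, hx, hxp, hxa⟩
  have hfreq : ∃ᶠ i in atTop, x i ∈ A ∨ x i ∈ B :=
    Frequently.of_forall fun i => (hx i).1
  rcases frequently_or_distrib.1 hfreq with h | h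
  all_goals obtain ⟨φ, hφ, hmem⟩ := extraction_of_frequently_atTop h
  · exact Or.inl ⟨ha, x ∘ φ, fun i => ⟨hmem i, (hx (φ i)).2⟩,
      hxp.comp hφ.tendsto_atTop, hxa.comp hφ.tendsto_atTop⟩
  · exact Or.inr ⟨ha, x ∘ φ, fun i => ⟨hmem i, (hx (φ i)).2⟩,
      hxp.comp hφ.tendsto_atTop, hxa.comp hφ.tendsto_atTop⟩

theorem dirBundle_mono {n : ℕ} {A B : Set (EuclideanSpace ℝ (Fin n))} (h : A ⊆ B) :
    dirBundle A ⊆ dirBundle B :=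
  fun q hq => ⟨h hq.1, dirSet_mono h q.1 hq.2⟩

theorem GD_mono {n : ℕ} {A B : Set (EuclideanSpace ℝ (Fin n))} (h : A ⊆ B) : GD A ⊆ GD B :=
  fun _ ha => closure_mono (dirBundle_mono h) ha

/-- If 0 ∈ cl(A) ∩ cl(B) and for every x one has {x} × D_x(A) ⊆ cl(D_A(A)) and
{x} × D_x(B) ⊆ cl(D_B(B)) (as holds for subanalytic sets), then
GD(A ∪ B) = GD(A) ∪ GD(B). -/
theorem stmt_3 {n : ℕ} (A B : Set (EuclideanSpace ℝ (Fin n)))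
    (hA : (0 : EuclideanSpace ℝ (Fin n)) ∈ closure A)
    (hB : (0 : EuclideanSpace ℝ (Fin n)) ∈ closure B)
    (hApprA : ∀ x : EuclideanSpace ℝ (Fin n), ∀ a ∈ dirSet A x, (x, a) ∈ closure (dirBundle A))
    (hApprB : ∀ x : EuclideanSpace ℝ (Fin n), ∀ a ∈ dirSet B x, (x, a) ∈ closure (dirBundle B)) :
    GD (A ∪ B) = GD A ∪ GD B := by
  refine Subset.antisymm ?_
    (union_subset (GD_mono subset_union_left) (GD_mono subset_union_right))
  have hsub : dirBundle (A ∪ B) ⊆ closure (dirBundle A ∪ dirBundle B) := by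
    rintro ⟨p, a⟩ ⟨-, ha⟩
    rw [closure_union]
    rw [dirSet_union] at ha
    exact ha.imp (hApprA p a) (hApprB p a)
  intro a ha
  have hmem := closure_minimal hsub isClosed_closure ha
  rwa [closure_union] at hmem
end

section
/- Let n ≥ 2 and let A = {(t, t², …, tⁿ) : t ∈ ℝ} ⊆ ℝⁿ. Then LGD^k(A) = ℝ·e₁ = {(t, 0, …, 0) : t ∈ ℝ} (the x₁-axis of ℝⁿ) for every integer k ≥ 1; in particular GD is stabilised at degree 1 for A. -/
open Filter Topology Metric Set

/-- The `x₁`-axis of `ℝⁿ`. -/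
def firstAxis (n : ℕ) : Set (EuclideanSpace ℝ (Fin n)) :=
  {v | ∀ i : Fin n, i.val ≠ 0 → v i = 0}

/-- The image of the moment curve `t ↦ (t, t², …, tⁿ)`. -/
def momentCurve (n : ℕ) : Set (EuclideanSpace ℝ (Fin n)) :=
  {v | ∃ t : ℝ, ∀ i : Fin n, v i = t ^ (i.val + 1)}

/-- Secants of `A` between points close to `0` are close to the `x₁`-axis. -/
def SecantsNearAxis {n : ℕ} (A : Set (EuclideanSpace ℝ (Fin n))) : Prop :=
  ∀ ε > 0, ∃ δ > 0, ∀ p ∈ A, ∀ x ∈ A, ‖p‖ < δ → ‖x‖ < δ →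
    ∀ i : Fin n, i.val ≠ 0 → |x i - p i| ≤ ε * ‖x - p‖

theorem mem_dirSet_zero_of_tendsto {n : ℕ} {A : Set (EuclideanSpace ℝ (Fin n))}
    {a : EuclideanSpace ℝ (Fin n)} (ha : ‖a‖ = 1) {c : ℕ → ℝ}
    {y : ℕ → EuclideanSpace ℝ (Fin n)} (hc : ∀ k, 0 < c k) (hc0 : Tendsto c atTop (𝓝 0))
    (hy : ∀ k, y k ≠ 0) (hya : Tendsto y atTop (𝓝 a)) (hA : ∀ k, c k • y k ∈ A) :
    a ∈ dirSet A 0 := by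
  refine ⟨ha, fun k => c k • y k, fun k => ⟨hA k, smul_ne_zero (hc k).ne' (hy k)⟩, ?_, ?_⟩
  · simpa using hc0.smul hya
  · have h : Tendsto (fun k => ‖y k‖⁻¹ • y k) atTop (𝓝 (‖a‖⁻¹ • a)) :=
      (hya.norm.inv₀ (by simp [ha])).smul hya
    rw [ha, inv_one, one_smul] at h
    refine h.congr fun k => ?_
    rw [sub_zero, norm_smul, Real.norm_of_nonneg (hc k).le, smul_smul, mul_inv_rev, mul_assoc,
      inv_mul_cancel₀ (hc k).ne', mul_one]

theorem SecantsNearAxis.GD_subset {n : ℕ} {A : Set (EuclideanSpace ℝ (Fin n))}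
    (h : SecantsNearAxis A) : GD A ⊆ firstAxis n := by
  intro a ha i hi
  suffices ∀ ε > 0, |a i| ≤ ε from
    abs_eq_zero.1 (le_antisymm (le_of_forall_pos_le_add fun ε hε => by simpa using this ε hε)
      (abs_nonneg _))
  intro ε hε
  obtain ⟨δ, hδ, H⟩ := h ε hε
  set U := {q : EuclideanSpace ℝ (Fin n) × EuclideanSpace ℝ (Fin n) | ‖q.1‖ < δ} with hU
  set C := {q : EuclideanSpace ℝ (Fin n) × EuclideanSpace ℝ (Fin n) | |q.2 i| ≤ ε} with hC
  have hopen : IsOpen U := isOpen_lt (by fun_prop) (by fun_prop)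
  have hcl : IsClosed C := isClosed_le (by fun_prop) (by fun_prop)
  have haU : ((0 : EuclideanSpace ℝ (Fin n)), a) ∈ U := by simpa [hU] using hδ
  suffices hsub : U ∩ dirBundle A ⊆ C from
    closure_minimal hsub hcl (hopen.inter_closure ⟨haU, ha⟩)
  rintro ⟨p, b⟩ ⟨hp, hpA, -, x, hxA, hxp, hxb⟩
  change ‖p‖ < δ at hp
  change |b i| ≤ ε
  have hlim : Tendsto (fun k => |((‖x k - p‖)⁻¹ • (x k - p)) i|) atTop (𝓝 |b i|) :=
    ((by fun_prop : Continuous fun v : EuclideanSpace ℝ (Fin n) => |v i|).tendsto b).comp hxb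
  refine le_of_tendsto hlim ?_
  filter_upwards [hxp.norm.eventually_lt_const hp] with k hk
  have hpos : 0 < ‖x k - p‖ := norm_pos_iff.2 (sub_ne_zero.2 (hxA k).2)
  have := H p hpA (x k) (hxA k).1 hp hk i hi
  rw [PiLp.smul_apply, PiLp.sub_apply, smul_eq_mul, abs_mul, abs_of_pos (inv_pos.2 hpos),
    inv_mul_le_iff₀ hpos, mul_comm]
  exact this

theorem single_zero_mem_firstAxis (n : ℕ) [NeZero n] :
    EuclideanSpace.single (0 : Fin n) (1 : ℝ) ∈ firstAxis n := by
  intro i hi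
  have : i ≠ 0 := fun h => hi (by simp [h])
  simp [this]

theorem SecantsNearAxis.LGD_eq {n : ℕ} [NeZero n] {A : Set (EuclideanSpace ℝ (Fin n))}
    (h : SecantsNearAxis A) (h0 : (0 : EuclideanSpace ℝ (Fin n)) ∈ A)
    (hdir : ∀ a ∈ firstAxis n, ‖a‖ = 1 → a ∈ dirSet A 0) : LGD A = firstAxis n := by
  have hGD : ∀ a ∈ firstAxis n, ‖a‖ = 1 → a ∈ GD A := fun a ha h1 =>
    subset_closure ⟨h0, hdir a ha h1⟩
  ext v
  constructor
  · rintro ⟨t, -, a, ha, rfl⟩ i hi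
    simp [h.GD_subset ha i hi]
  · intro hv
    rcases eq_or_ne v 0 with rfl | hne
    · exact ⟨0, le_rfl, _, hGD _ (single_zero_mem_firstAxis n) (by simp), by simp⟩
    · have hn : ‖v‖ ≠ 0 := norm_ne_zero_iff.2 hne
      refine ⟨‖v‖, norm_nonneg v, ‖v‖⁻¹ • v, hGD _ (fun i hi => ?_) ?_, ?_⟩
      · simp [hv i hi]
      · rw [norm_smul, norm_inv, norm_norm, inv_mul_cancel₀ hn]
      · rw [smul_smul, mul_inv_cancel₀ hn, one_smul]

theorem LGD_firstAxis (n : ℕ) [NeZero n] : LGD (firstAxis n) = firstAxis n := by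
  refine SecantsNearAxis.LGD_eq ?_ (fun i _ => rfl) fun a ha h1 => ?_
  · refine fun ε hε => ⟨1, one_pos, fun p hp x hx _ _ i hi => ?_⟩
    rw [hp i hi, hx i hi, sub_zero, abs_zero]
    positivity
  · refine mem_dirSet_zero_of_tendsto h1 (fun k => Nat.one_div_pos_of_nat)
      tendsto_one_div_add_atTop_nhds_zero_nat (y := fun _ => a)
      (fun _ => norm_ne_zero_iff.1 (by simp [h1])) tendsto_const_nhds fun k i hi => ?_
    simp [ha i hi]

theorem secantsNearAxis_momentCurve (n : ℕ) [NeZero n] : SecantsNearAxis (momentCurve n) := by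
  intro ε hε
  have hn : (0 : ℝ) < n := Nat.cast_pos.2 (NeZero.pos n)
  refine ⟨min 1 (ε / n), by positivity, ?_⟩
  rintro p ⟨s, hs⟩ x ⟨t, ht⟩ hp hx i hi
  have hp0 : |s| ≤ ‖p‖ := by simpa [hs 0] using PiLp.norm_apply_le p 0
  have hx0 : |t| ≤ ‖x‖ := by simpa [ht 0] using PiLp.norm_apply_le x 0
  have hxp : |t - s| ≤ ‖x - p‖ := by simpa [hs 0, ht 0] using PiLp.norm_apply_le (x - p) 0
  have hm : max |t| |s| < min 1 (ε / n) := max_lt (hx0.trans_lt hx) (hp0.trans_lt hp)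
  have hm0 : 0 ≤ max |t| |s| := (abs_nonneg t).trans (le_max_left _ _)
  have hpow : max |t| |s| ^ i.val ≤ ε / n :=
    (pow_le_of_le_one hm0 (hm.le.trans (min_le_left _ _)) hi).trans
      (hm.le.trans (min_le_right _ _))
  have hin : ((i.val + 1 : ℕ) : ℝ) ≤ n := Nat.cast_le.2 i.isLt
  rw [hs i, ht i]
  calc |t ^ (i.val + 1) - s ^ (i.val + 1)|
      ≤ |t - s| * (i.val + 1 : ℕ) * max |t| |s| ^ i.val := by
        simpa using abs_pow_sub_pow_le t s (i.val + 1)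
    _ ≤ ‖x - p‖ * n * (ε / n) := by gcongr
    _ = ε * ‖x - p‖ := by field_simp

theorem mem_dirSet_momentCurve {n : ℕ} [NeZero n] {a : EuclideanSpace ℝ (Fin n)}
    (ha : a ∈ firstAxis n) (h1 : ‖a‖ = 1) : a ∈ dirSet (momentCurve n) 0 := by
  have ha0 : a 0 ≠ 0 := by
    intro h
    have : a = 0 := by
      ext i
      by_cases hi : i.val = 0
      · rw [show i = 0 from Fin.ext (by simpa using hi), h]; rfl
      · exact ha i hi
    simp [this] at h1
  refine mem_dirSet_zero_of_tendsto h1 (c := fun k : ℕ => 1 / ((k : ℝ) + 1))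
    (y := fun k => WithLp.toLp 2 fun i : Fin n => (1 / ((k : ℝ) + 1)) ^ i.val * a 0 ^ (i.val + 1))
    (fun k => Nat.one_div_pos_of_nat) tendsto_one_div_add_atTop_nhds_zero_nat
    (fun k h => ha0 ?_) ?_ fun k => ?_
  · simpa using congrArg (fun v : EuclideanSpace ℝ (Fin n) => v 0) h
  · have : Tendsto (fun (k : ℕ) (i : Fin n) => (1 / ((k : ℝ) + 1)) ^ i.val * a 0 ^ (i.val + 1))
        atTop (𝓝 (WithLp.ofLp a)) := by
      refine tendsto_pi_nhds.2 fun i => ?_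
      have h := ((tendsto_one_div_add_atTop_nhds_zero_nat (𝕜 := ℝ)).pow i.val).mul_const
        (a 0 ^ (i.val + 1))
      by_cases hi : i.val = 0
      · rw [show i = 0 from Fin.ext (by simpa using hi)]
        simp
      · rw [ha i hi]
        simpa [hi] using h
    exact ((PiLp.continuous_toLp 2 _).tendsto _).comp this
  · refine ⟨1 / ((k : ℝ) + 1) * a 0, fun i => ?_⟩
    simp only [PiLp.smul_apply, smul_eq_mul]
    ring

theorem LGD_momentCurve (n : ℕ) [NeZero n] : LGD (momentCurve n) = firstAxis n :=
  (secantsNearAxis_momentCurve n).LGD_eq ⟨0, fun i => by simp⟩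
    fun _ => mem_dirSet_momentCurve

/-- For A the image of γ(t) = (t, t², …, tⁿ) in ℝⁿ, n ≥ 2, one has
LGD^[k](A) = ℝ·e₁ (the x₁-axis) for every k ≥ 1; in particular GD is stabilised
at degree 1 for A. -/
theorem stmt_5 (n : ℕ) (hn : 2 ≤ n)
    (A : Set (EuclideanSpace ℝ (Fin n)))
    (hA : A = {v | ∃ t : ℝ, ∀ i : Fin n, v i = t ^ (i.val + 1)}) :
    ∀ k : ℕ, 1 ≤ k →
      LGD^[k] A = {v : EuclideanSpace ℝ (Fin n) | ∀ i : Fin n, i.val ≠ 0 → v i = 0} := by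
  have : NeZero n := ⟨by omega⟩
  intro k hk
  obtain ⟨m, rfl⟩ := Nat.exists_eq_add_of_le' hk
  rw [Function.iterate_succ_apply, show LGD A = firstAxis n from hA ▸ LGD_momentCurve n]
  exact Function.iterate_fixed (LGD_firstAxis n) m
end

section
/- Let A₊ = {(x,y,z) ∈ ℝ³ : z² = x² + y², z > 0}, A₋ = {(x,y,z) ∈ ℝ³ : z² = x² + y², z < 0}, and A = A₊ ∪ A₋. Then LGD(A₊) = LGD(A₋) = LGD(A) = {(x,y,z) ∈ ℝ³ : z² ≤ x² + y²}. -/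
open Filter Topology Metric Set

/-- The unit velocity of a curve that stays in `A` is a direction of `A`. -/
theorem mem_dirSet_of_hasDerivAt {n : ℕ} {A : Set (EuclideanSpace ℝ (Fin n))}
    {γ : ℝ → EuclideanSpace ℝ (Fin n)} {a : EuclideanSpace ℝ (Fin n)}
    (hγ : HasDerivAt γ a 0) (ha : ‖a‖ = 1) (hA : ∀ᶠ t in 𝓝 0, γ t ∈ A) :
    a ∈ dirSet A (γ 0) := by
  have hslope : Tendsto (slope γ 0) (𝓝[>] 0) (𝓝 a) :=
    (hasDerivAt_iff_tendsto_slope.1 hγ).mono_left (nhdsWithin_mono _ fun t ht => ne_of_gt ht)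
  have ha0 : a ≠ 0 := norm_ne_zero_iff.1 (by simp [ha])
  have hev : ∀ᶠ t in 𝓝[>] (0 : ℝ), γ t ∈ A ∧ γ t ≠ γ 0 := by
    filter_upwards [hA.filter_mono nhdsWithin_le_nhds, hslope.eventually_ne ha0] with t ht hne
    refine ⟨ht, fun h => hne ?_⟩
    simp [slope, h]
  have hdir : Tendsto (fun t => (‖γ t - γ 0‖)⁻¹ • (γ t - γ 0)) (𝓝[>] 0) (𝓝 a) := by
    have h := (hslope.norm.inv₀ (norm_ne_zero_iff.2 ha0)).smul hslope
    rw [ha, inv_one, one_smul] at h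
    refine h.congr' ?_
    filter_upwards [self_mem_nhdsWithin] with t ht
    have ht' : 0 < t := ht
    simp only [slope, vsub_eq_sub, sub_zero, norm_smul, norm_inv, Real.norm_eq_abs,
      abs_of_pos ht', smul_smul]
    congr 1
    field_simp
  obtain ⟨u, hu, huA⟩ := exists_seq_forall_of_frequently hev.frequently
  exact ⟨ha, γ ∘ u, huA, hγ.continuousAt.tendsto.comp (hu.mono_right nhdsWithin_le_nhds),
    hdir.comp hu⟩

/-- A point outside the open solid cone lies on a tangent plane of the cone. -/
theorem exists_tangent_generator {x y z : ℝ} (h : z ^ 2 ≤ x ^ 2 + y ^ 2) :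
    ∃ c d : ℝ, c ^ 2 + d ^ 2 = 1 ∧ c * x + d * y = z := by
  rcases eq_or_ne (x ^ 2 + y ^ 2) 0 with hr | hr
  · have hx : x = 0 := by nlinarith [sq_nonneg x, sq_nonneg y]
    have hy : y = 0 := by nlinarith [sq_nonneg x, sq_nonneg y]
    have hz : z = 0 := by nlinarith [sq_nonneg z]
    exact ⟨1, 0, by norm_num, by simp [hx, hz]⟩
  · have hs := Real.sq_sqrt (sub_nonneg.2 h)
    set w := √(x ^ 2 + y ^ 2 - z ^ 2)
    refine ⟨(x * z - y * w) / (x ^ 2 + y ^ 2), (y * z + x * w) / (x ^ 2 + y ^ 2), ?_, ?_⟩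
    · field_simp
      linear_combination (x ^ 2 + y ^ 2) * hs
    · field_simp
      ring

/-- The nappe of the cone `z² = x² + y²` on which `z` has the sign of `s`. -/
def nappe (s : ℝ) : Set (EuclideanSpace ℝ (Fin 3)) :=
  {v | (v 2) ^ 2 = (v 0) ^ 2 + (v 1) ^ 2 ∧ 0 < s * v 2}

theorem mem_dirSet_nappe {s c d r : ℝ} {a : EuclideanSpace ℝ (Fin 3)} (ha : ‖a‖ = 1)
    (hcd : c ^ 2 + d ^ 2 = 1) (hac : c * a 0 + d * a 1 = a 2) (hr : 0 < s * r) :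
    a ∈ dirSet (nappe s) (r • !₂[c, d, 1]) := by
  have hr0 : r ≠ 0 := by rintro rfl; simp at hr
  set q := a 0 ^ 2 + a 1 ^ 2 - a 2 ^ 2 with hq
  set μ : ℝ → ℝ := fun t => -(t ^ 2 * q) / (4 * (r + t * a 2)) with hμ
  set γ : ℝ → EuclideanSpace ℝ (Fin 3) :=
    fun t => r • !₂[c, d, 1] + t • a + μ t • !₂[c, d, -1] with hγ
  have hμ' : HasDerivAt μ 0 0 := by
    have h1 : HasDerivAt (fun t : ℝ => -(t ^ 2 * q)) 0 0 := 
      (((hasDerivAt_id (0 : ℝ)).pow 2).mul_const q).neg.congr_deriv (by simp)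
    have h2 : HasDerivAt (fun t : ℝ => 4 * (r + t * a 2)) (4 * a 2) 0 :=
      ((((hasDerivAt_id (0 : ℝ)).mul_const (a 2)).const_add r).const_mul 4).congr_deriv (by simp)
    exact (h1.div h2 (by simpa using hr0)).congr_deriv (by simp)
  have hγ' : HasDerivAt γ a 0 :=
    ((((hasDerivAt_id (0 : ℝ)).smul_const a).const_add (r • !₂[c, d, 1])).add
      (hμ'.smul_const !₂[c, d, -1])).congr_deriv (by simp)
  have hγ0 : γ 0 = r • !₂[c, d, 1] := by simp [hγ, hμ]
  have hmem : ∀ᶠ t in 𝓝 0, γ t ∈ nappe s := by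
    have hlin : ∀ᶠ t in 𝓝 (0 : ℝ), r + t * a 2 ≠ 0 := by
      have : ContinuousAt (fun t : ℝ => r + t * a 2) 0 := by fun_prop
      exact this.eventually_ne (by simpa using hr0)
    have hpos : ∀ᶠ t in 𝓝 (0 : ℝ), 0 < s * γ t 2 := by
      have hc : ContinuousAt (fun t => s * γ t 2) 0 := by
        have := hγ'.continuousAt
        fun_prop
      refine hc.eventually_const_lt ?_
      simp only [hγ0]
      simpa using hr
    filter_upwards [hlin, hpos] with t ht hp
    refine ⟨?_, hp⟩
    have hm : μ t * (4 * (r + t * a 2)) = -(t ^ 2 * q) := by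
      simp only [hμ]
      field_simp
    simp only [hγ, PiLp.add_apply, PiLp.smul_apply, smul_eq_mul]
    simp
    linear_combination (-(r + μ t) ^ 2) * hcd - 2 * t * (r + μ t) * hac - hm - t ^ 2 * hq
  rw [← hγ0]
  exact mem_dirSet_of_hasDerivAt hγ' ha hmem

theorem mem_GD_nappe {s : ℝ} (hs : s ≠ 0) {a : EuclideanSpace ℝ (Fin 3)} (ha : ‖a‖ = 1)
    (h : (a 2) ^ 2 ≤ (a 0) ^ 2 + (a 1) ^ 2) : a ∈ GD (nappe s) := by
  obtain ⟨c, d, hcd, hac⟩ := exists_tangent_generator h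
  have hlim : Tendsto (fun ε : ℝ => ((ε * s) • !₂[c, d, 1], a)) (𝓝[>] 0)
      (𝓝 ((0 : EuclideanSpace ℝ (Fin 3)), a)) := by
    have : Continuous fun ε : ℝ => ((ε * s) • !₂[c, d, 1], a) := by fun_prop
    simpa using (this.tendsto 0).mono_left nhdsWithin_le_nhds
  refine mem_closure_of_tendsto hlim ?_
  filter_upwards [self_mem_nhdsWithin] with ε hε
  have hpos : 0 < s * (ε * s) := by
    have : 0 < ε * s ^ 2 := mul_pos hε (by positivity)
    linarith
  refine ⟨⟨?_, by simpa using hpos⟩, mem_dirSet_nappe ha hcd hac hpos⟩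
  simp
  linear_combination (-(ε * s) ^ 2) * hcd

theorem sq_le_of_mem_dirSet {A : Set (EuclideanSpace ℝ (Fin 3))}
    (hA : ∀ v ∈ A, (v 2) ^ 2 = (v 0) ^ 2 + (v 1) ^ 2 ∧ v 2 ≠ 0)
    {p a : EuclideanSpace ℝ (Fin 3)} (hp : p ∈ A) (ha : a ∈ dirSet A p) :
    (a 2) ^ 2 ≤ (a 0) ^ 2 + (a 1) ^ 2 := by
  obtain ⟨-, x, hx, hxp, hdir⟩ := ha
  obtain ⟨hp1, hp2⟩ := hA p hp
  let B : EuclideanSpace ℝ (Fin 3) × EuclideanSpace ℝ (Fin 3) → ℝ :=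
    fun w => w.1 0 * w.2 0 + w.1 1 * w.2 1 - w.1 2 * w.2 2
  have hB : Continuous B := by fun_prop
  have hlim := (hB.tendsto (a, p + p)).comp (hdir.prodMk_nhds (hxp.add_const p))
  have hzero : ∀ i, B ((‖x i - p‖)⁻¹ • (x i - p), x i + p) = 0 := by
    intro i
    simp only [B, PiLp.add_apply, PiLp.smul_apply, PiLp.sub_apply, smul_eq_mul]
    linear_combination (‖x i - p‖)⁻¹ * (hp1 - (hA _ (hx i).1).1)
  have htan : B (a, p + p) = 0 :=
    tendsto_nhds_unique hlim (tendsto_const_nhds.congr fun i => (hzero i).symm)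
  have htan' : a 2 * p 2 = a 0 * p 0 + a 1 * p 1 := by
    simp only [B, PiLp.add_apply] at htan
    linarith
  have hmul : (p 2) ^ 2 * (a 2) ^ 2 ≤ (p 2) ^ 2 * ((a 0) ^ 2 + (a 1) ^ 2) := by
    have : (p 2) ^ 2 * (a 2) ^ 2 = (a 0 * p 0 + a 1 * p 1) ^ 2 := by rw [← htan']; ring
    rw [this, hp1]
    nlinarith [sq_nonneg (a 0 * p 1 - a 1 * p 0)]
  exact le_of_mul_le_mul_left hmul (by positivity)

theorem sq_le_of_mem_GD {A : Set (EuclideanSpace ℝ (Fin 3))}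
    (hA : ∀ v ∈ A, (v 2) ^ 2 = (v 0) ^ 2 + (v 1) ^ 2 ∧ v 2 ≠ 0)
    {a : EuclideanSpace ℝ (Fin 3)} (ha : a ∈ GD A) :
    (a 2) ^ 2 ≤ (a 0) ^ 2 + (a 1) ^ 2 := by
  have hclosed : IsClosed {w : EuclideanSpace ℝ (Fin 3) × EuclideanSpace ℝ (Fin 3) |
      (w.2 2) ^ 2 ≤ (w.2 0) ^ 2 + (w.2 1) ^ 2} :=
    isClosed_le (by fun_prop) (by fun_prop)
  exact closure_minimal (fun w hw => sq_le_of_mem_dirSet hA hw.1 hw.2) hclosed ha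

theorem LGD_eq_of_nappe_subset {A : Set (EuclideanSpace ℝ (Fin 3))} {s : ℝ} (hs : s ≠ 0)
    (hsA : nappe s ⊆ A) (hA : ∀ v ∈ A, (v 2) ^ 2 = (v 0) ^ 2 + (v 1) ^ 2 ∧ v 2 ≠ 0) :
    LGD A = {v : EuclideanSpace ℝ (Fin 3) | (v 2) ^ 2 ≤ (v 0) ^ 2 + (v 1) ^ 2} := by
  ext v
  constructor
  · rintro ⟨t, -, a, ha, rfl⟩
    have h := mul_le_mul_of_nonneg_left (sq_le_of_mem_GD hA ha) (sq_nonneg t)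
    simp only [mem_ofPred_eq, PiLp.smul_apply, smul_eq_mul]
    linarith
  · intro hv
    rcases eq_or_ne v 0 with rfl | hv0
    · exact ⟨0, le_rfl, EuclideanSpace.single 0 1,
        GD_mono hsA (mem_GD_nappe hs (by simp) (by simp)), by simp⟩
    · have hn : ‖v‖ ≠ 0 := norm_ne_zero_iff.2 hv0
      refine ⟨‖v‖, norm_nonneg v, ‖v‖⁻¹ • v, GD_mono hsA (mem_GD_nappe hs ?_ ?_), ?_⟩
      · simp [norm_smul, hn]
      · have h := mul_le_mul_of_nonneg_left (show (v 2) ^ 2 ≤ (v 0) ^ 2 + (v 1) ^ 2 from hv)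
          (sq_nonneg ‖v‖⁻¹)
        simp only [PiLp.smul_apply, smul_eq_mul]
        linarith
      · rw [smul_inv_smul₀ hn]

/-- For the upper and lower cones A₊, A₋ of z² = x² + y² in ℝ³ and A = A₊ ∪ A₋,
LGD(A₊) = LGD(A₋) = LGD(A) = {z² ≤ x² + y²}. -/
theorem stmt_6 (Ap Am : Set (EuclideanSpace ℝ (Fin 3)))
    (hAp : Ap = {v | (v 2) ^ 2 = (v 0) ^ 2 + (v 1) ^ 2 ∧ 0 < v 2})
    (hAm : Am = {v | (v 2) ^ 2 = (v 0) ^ 2 + (v 1) ^ 2 ∧ v 2 < 0}) :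
    LGD Ap = {v : EuclideanSpace ℝ (Fin 3) | (v 2) ^ 2 ≤ (v 0) ^ 2 + (v 1) ^ 2} ∧
    LGD Am = {v : EuclideanSpace ℝ (Fin 3) | (v 2) ^ 2 ≤ (v 0) ^ 2 + (v 1) ^ 2} ∧
    LGD (Ap ∪ Am) = {v : EuclideanSpace ℝ (Fin 3) | (v 2) ^ 2 ≤ (v 0) ^ 2 + (v 1) ^ 2} := by
  have hp : Ap = nappe 1 := by simp [hAp, nappe]
  have hm : Am = nappe (-1) := by simp [hAm, nappe]
  have hcone : ∀ s, ∀ v ∈ nappe s, (v 2) ^ 2 = (v 0) ^ 2 + (v 1) ^ 2 ∧ v 2 ≠ 0 :=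
    fun s v hv => ⟨hv.1, right_ne_zero_of_mul hv.2.ne'⟩
  rw [hp, hm]
  refine ⟨LGD_eq_of_nappe_subset one_ne_zero subset_rfl (hcone 1),
    LGD_eq_of_nappe_subset (by norm_num) subset_rfl (hcone (-1)),
    LGD_eq_of_nappe_subset one_ne_zero subset_union_left ?_⟩
  rintro v (hv | hv)
  exacts [hcone 1 v hv, hcone (-1) v hv]
end

section
/- Let A = {(x,y,z) ∈ ℝ³ : z² = x² + y², z ≠ 0}. Then LGD²(A) = ℝ³, i.e. LGD({(x,y,z) ∈ ℝ³ : z² ≤ x² + y²}) = ℝ³; in particular GD is stabilised at degree 2 for A. -/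
open Filter Topology Metric Set

/-- Directions in `A` at `γ 0` include the normalised velocity of any curve `γ` in `A`. -/
theorem normalize_mem_dirSet {n : ℕ} {A : Set (EuclideanSpace ℝ (Fin n))}
    {γ : ℝ → EuclideanSpace ℝ (Fin n)} {v : EuclideanSpace ℝ (Fin n)} (hv : v ≠ 0)
    (hγ : HasDerivAt γ v 0) (hA : ∀ᶠ t in 𝓝 0, γ t ∈ A) :
    ‖v‖⁻¹ • v ∈ dirSet A (γ 0) := by
  refine ⟨norm_smul_inv_norm hv, ?_⟩
  have hslope := hγ.tendsto_slope
  have hev : ∀ᶠ t in 𝓝[>] (0 : ℝ), γ t ∈ A ∧ γ t ≠ γ 0 := by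
    refine (hA.filter_mono nhdsWithin_le_nhds).and ?_
    exact (hγ.eventually_ne hv).filter_mono (nhdsWithin_mono _ fun t ht => ne_of_gt ht)
  have hu : Tendsto (fun i : ℕ => 1 / ((i : ℝ) + 1)) atTop (𝓝[>] 0) :=
    tendsto_nhdsWithin_iff.2 ⟨tendsto_one_div_add_atTop_nhds_zero_nat,
      Eventually.of_forall fun i => by simp only [Set.mem_Ioi]; positivity⟩
  obtain ⟨N, hN⟩ := eventually_atTop.1 (hu.eventually hev)
  have huN := hu.comp (tendsto_add_atTop_nat N)
  refine ⟨fun i => γ (1 / (((i + N : ℕ) : ℝ) + 1)), fun i => hN (i + N) (by omega), ?_, ?_⟩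
  · exact hγ.continuousAt.tendsto.comp (huN.mono_right nhdsWithin_le_nhds)
  · have hs := (hslope.mono_left
      (nhdsWithin_mono _ fun t (ht : t ∈ Set.Ioi (0 : ℝ)) => ne_of_gt ht)).comp huN
    refine ((hs.norm.inv₀ (norm_ne_zero_iff.2 hv)).smul hs).congr fun i => ?_
    have ht : (0 : ℝ) < 1 / (((i + N : ℕ) : ℝ) + 1) := by positivity
    simp only [Function.comp_apply]
    generalize 1 / (((i + N : ℕ) : ℝ) + 1) = t at ht
    rw [slope_def_module, sub_zero, norm_smul, norm_inv, Real.norm_of_nonneg ht.le, mul_inv,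
      inv_inv, smul_smul]
    congr 1
    field_simp

theorem LGD_mono {n : ℕ} {A B : Set (EuclideanSpace ℝ (Fin n))} (h : A ⊆ B) :
    LGD A ⊆ LGD B := by
  rintro x ⟨t, ht, a, ha, rfl⟩
  exact ⟨t, ht, a, GD_mono h ha, rfl⟩

theorem zero_mem_LGD {n : ℕ} {A : Set (EuclideanSpace ℝ (Fin n))}
    {v : EuclideanSpace ℝ (Fin n)} (h : v ∈ LGD A) : 0 ∈ LGD A := by
  obtain ⟨-, -, a, ha, -⟩ := h
  exact ⟨0, le_rfl, a, ha, (zero_smul ℝ a).symm⟩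

/-- If `v` is tangent to `A` at every point of an open ray from the origin, then `v ∈ LGD A`. -/
theorem mem_LGD_of_tangent_along_ray {n : ℕ} {A : Set (EuclideanSpace ℝ (Fin n))}
    {p v : EuclideanSpace ℝ (Fin n)} (hv : v ≠ 0)
    (h : ∀ r : ℝ, 0 < r → ∃ γ : ℝ → EuclideanSpace ℝ (Fin n),
      γ 0 = r • p ∧ HasDerivAt γ v 0 ∧ ∀ᶠ t in 𝓝 0, γ t ∈ A) :
    v ∈ LGD A := by
  refine ⟨‖v‖, norm_nonneg v, ‖v‖⁻¹ • v, ?_, ?_⟩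
  · have hlim : Tendsto (fun r : ℝ => (r • p, ‖v‖⁻¹ • v)) (𝓝[>] 0) (𝓝 (0, ‖v‖⁻¹ • v)) := by
      have hc : Continuous fun r : ℝ => (r • p, ‖v‖⁻¹ • v) := by fun_prop
      simpa using (hc.tendsto 0).mono_left nhdsWithin_le_nhds
    refine mem_closure_of_tendsto hlim (eventually_mem_nhdsWithin.mono fun r hr => ?_)
    obtain ⟨γ, h0, hγ, hA⟩ := h r hr
    exact ⟨h0 ▸ hA.self_of_nhds, h0 ▸ normalize_mem_dirSet hv hγ hA⟩
  · rw [smul_smul, mul_inv_cancel₀ (norm_ne_zero_iff.2 hv), one_smul]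

theorem LGD_solid_cone :
    LGD {v : EuclideanSpace ℝ (Fin 3) | (v 2) ^ 2 ≤ (v 0) ^ 2 + (v 1) ^ 2} = Set.univ := by
  have key : ∀ v : EuclideanSpace ℝ (Fin 3), v ≠ 0 →
      v ∈ LGD {v : EuclideanSpace ℝ (Fin 3) | (v 2) ^ 2 ≤ (v 0) ^ 2 + (v 1) ^ 2} := by
    intro v hv
    refine mem_LGD_of_tangent_along_ray (p := !₂[1, 0, 0]) hv fun r hr =>
      ⟨fun t => r • !₂[1, 0, 0] + t • v, by simp, ?_, ?_⟩
    · simpa using ((hasDerivAt_id (0 : ℝ)).smul_const v).const_add (r • !₂[(1 : ℝ), 0, 0])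
    · have h1 : ContinuousAt (fun t : ℝ => (t * v 2) ^ 2) 0 := by fun_prop
      have h2 : ContinuousAt (fun t : ℝ => (r + t * v 0) ^ 2 + (t * v 1) ^ 2) 0 := by fun_prop
      have h3 := h1.eventually_lt h2 (by simp; positivity)
      filter_upwards [h3] with t ht
      simpa using ht.le
  refine Set.eq_univ_of_forall fun v => ?_
  by_cases hv : v = 0
  · rw [hv]
    refine zero_mem_LGD (key !₂[1, 0, 0] fun h => ?_)
    simpa using congrArg (fun w : EuclideanSpace ℝ (Fin 3) => w 0) h
  · exact key v hv

/-- A vector in the tangent plane of the cone `z² = x² + y²` at `(c, s, 1)` lies in the `LGD` of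
the cone without its apex. -/
theorem mem_LGD_punctured_cone {c s : ℝ} (hcs : c ^ 2 + s ^ 2 = 1)
    {v : EuclideanSpace ℝ (Fin 3)} (hv : v ≠ 0) (hz : c * v 0 + s * v 1 = v 2) :
    v ∈ LGD {v : EuclideanSpace ℝ (Fin 3) | (v 2) ^ 2 = (v 0) ^ 2 + (v 1) ^ 2 ∧ v 2 ≠ 0} := by
  refine mem_LGD_of_tangent_along_ray (p := !₂[c, s, 1]) hv fun r hr => ?_
  let q : ℝ → ℝ := fun t => (r * c + t * v 0) ^ 2 + (r * s + t * v 1) ^ 2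
  have hq0 : q 0 = r ^ 2 := by
    simp only [q]
    linear_combination r ^ 2 * hcs
  have hlin (a b : ℝ) : HasDerivAt (fun t : ℝ => a + t * b) b 0 := by
    simpa using ((hasDerivAt_id (0 : ℝ)).mul_const b).const_add a
  have hq : HasDerivAt q (2 * r * v 2) 0 := by
    refine (((hlin (r * c) (v 0)).fun_pow 2).fun_add ((hlin (r * s) (v 1)).fun_pow 2)).congr_deriv ?_
    simp only [Nat.cast_ofNat, Nat.add_one_sub_one, pow_one, zero_mul, add_zero]
    linear_combination 2 * r * hz
  have hsqrt : HasDerivAt (fun t => √(q t)) (v 2) 0 := by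
    refine (hq.sqrt (by rw [hq0]; positivity)).congr_deriv ?_
    rw [hq0, Real.sqrt_sq hr.le]
    field_simp
  refine ⟨fun t => !₂[r * c + t * v 0, r * s + t * v 1, √(q t)], ?_, ?_, ?_⟩
  · ext i
    fin_cases i <;> simp [hq0, Real.sqrt_sq hr.le]
  · rw [hasDerivAt_iff_hasFDerivAt, ← hasFDerivWithinAt_univ, hasFDerivWithinAt_euclidean]
    intro i
    rw [hasFDerivWithinAt_univ]
    fin_cases i
    · exact (hlin (r * c) (v 0)).hasFDerivAt.congr_fderiv (by ext; simp)
    · exact (hlin (r * s) (v 1)).hasFDerivAt.congr_fderiv (by ext; simp)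
    · exact hsqrt.hasFDerivAt.congr_fderiv (by ext; simp)
  · have hpos : ∀ᶠ t in 𝓝 0, 0 < q t :=
      hq.continuousAt.eventually_const_lt (by rw [hq0]; positivity)
    filter_upwards [hpos] with t ht
    refine ⟨?_, ?_⟩
    · simpa [q] using Real.sq_sqrt ht.le
    · simpa using (Real.sqrt_pos.2 ht).ne'

theorem solid_cone_subset_LGD_punctured_cone :
    {v : EuclideanSpace ℝ (Fin 3) | (v 2) ^ 2 ≤ (v 0) ^ 2 + (v 1) ^ 2} ⊆
      LGD {v : EuclideanSpace ℝ (Fin 3) | (v 2) ^ 2 = (v 0) ^ 2 + (v 1) ^ 2 ∧ v 2 ≠ 0} := by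
  intro v hle
  rw [Set.mem_ofPred_eq] at hle
  by_cases hv : v = 0
  · rw [hv]
    have hne : (!₂[1, 0, 1] : EuclideanSpace ℝ (Fin 3)) ≠ 0 := fun h => by
      simpa using congrArg (fun w : EuclideanSpace ℝ (Fin 3) => w 0) h
    exact zero_mem_LGD (mem_LGD_punctured_cone (c := 1) (s := 0) (by norm_num) hne (by simp))
  · have hρ : v 0 ^ 2 + v 1 ^ 2 ≠ 0 := by
      intro h0
      apply hv
      ext i
      fin_cases i <;> simp <;> nlinarith [sq_nonneg (v 0), sq_nonneg (v 1), sq_nonneg (v 2)]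
    have hw := Real.sq_sqrt (sub_nonneg.2 hle)
    set w := √(v 0 ^ 2 + v 1 ^ 2 - v 2 ^ 2)
    refine mem_LGD_punctured_cone (c := (v 0 * v 2 - v 1 * w) / (v 0 ^ 2 + v 1 ^ 2))
      (s := (v 1 * v 2 + v 0 * w) / (v 0 ^ 2 + v 1 ^ 2)) ?_ hv ?_
    · field_simp
      linear_combination (v 0 ^ 2 + v 1 ^ 2) * hw
    · field_simp
      ring

/-- For A = {z² = x² + y², z ≠ 0} ⊆ ℝ³ one has LGD²(A) = ℝ³, i.e.
LGD({z² ≤ x² + y²}) = ℝ³; in particular GD is stabilised at degree 2 for A. -/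
theorem stmt_7 (A : Set (EuclideanSpace ℝ (Fin 3)))
    (hA : A = {v | (v 2) ^ 2 = (v 0) ^ 2 + (v 1) ^ 2 ∧ v 2 ≠ 0}) :
    LGD (LGD A) = Set.univ ∧
    LGD {v : EuclideanSpace ℝ (Fin 3) | (v 2) ^ 2 ≤ (v 0) ^ 2 + (v 1) ^ 2} = Set.univ := by
  subst hA
  refine ⟨Set.eq_univ_of_univ_subset ?_, LGD_solid_cone⟩
  rw [← LGD_solid_cone]
  exact LGD_mono solid_cone_subset_LGD_punctured_cone
end

section
/- Let A₀ = {(x,y,z) ∈ ℝ³ : x² + y² = z⁴}. Then LGD(A₀) = ℝ³; in particular GD is stabilised at degree 1 for A₀. -/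
open Filter Topology Metric Set

/-- A nonzero velocity of a differentiable curve in `A` is, once normalised, a direction of `A`
at the base point of the curve. -/
lemma mem_dirBundle_of_hasDerivAt {n : ℕ} {A : Set (EuclideanSpace ℝ (Fin n))}
    {γ : ℝ → EuclideanSpace ℝ (Fin n)} {v : EuclideanSpace ℝ (Fin n)}
    (hγ : HasDerivAt γ v 0) (hv : v ≠ 0) (hA : ∀ s, γ s ∈ A) :
    (γ 0, ‖v‖⁻¹ • v) ∈ dirBundle A := by
  have hne : ∀ᶠ s in 𝓝[>] (0 : ℝ), γ s ≠ γ 0 ∧ 0 < s :=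
    ((hγ.eventually_ne hv).filter_mono (nhdsWithin_mono _ fun s hs => ne_of_gt hs)).and
      self_mem_nhdsWithin
  obtain ⟨s, hs, hs'⟩ := exists_seq_forall_of_frequently hne.frequently
  have hslope := hγ.tendsto_slope_zero_right.comp hs
  refine ⟨hA 0, ?_, γ ∘ s, fun i => ⟨hA _, (hs' i).1⟩,
    hγ.continuousAt.tendsto.comp (hs.mono_right nhdsWithin_le_nhds), ?_⟩
  · rw [norm_smul, norm_inv, norm_norm, inv_mul_cancel₀ (norm_ne_zero_iff.2 hv)]
  · refine ((hslope.norm.inv₀ (norm_ne_zero_iff.2 hv)).smul hslope).congr fun i => ?_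
    have hpos := (hs' i).2
    simp only [Function.comp_apply, zero_add, norm_smul, smul_smul, norm_inv, Real.norm_eq_abs,
      abs_of_pos hpos, mul_inv, inv_inv]
    congr 1
    field_simp

/-- Every unit vector is in the geometric directional bundle of `x² + y² = z⁴` at `0`. -/
lemma mem_GD_of_norm_eq_one {a : EuclideanSpace ℝ (Fin 3)} (ha : ‖a‖ = 1) :
    a ∈ GD {v : EuclideanSpace ℝ (Fin 3) | (v 0) ^ 2 + (v 1) ^ 2 = (v 2) ^ 4} := by
  obtain ⟨r, θ, h0, h1⟩ : ∃ r θ : ℝ, a 0 = -(r * Real.sin θ) ∧ a 1 = r * Real.cos θ := by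
    refine ⟨‖(⟨a 1, -a 0⟩ : ℂ)‖, Complex.arg ⟨a 1, -a 0⟩, ?_, ?_⟩
    · rw [Complex.norm_mul_sin_arg, neg_neg]
    · rw [Complex.norm_mul_cos_arg]
  let P : ℝ → EuclideanSpace ℝ (Fin 3) := fun t => !₂[t ^ 2 * Real.cos θ, t ^ 2 * Real.sin θ, t]
  let V : ℝ → EuclideanSpace ℝ (Fin 3) :=
    fun t => a + (2 * t * a 2) • !₂[Real.cos θ, Real.sin θ, 0]
  have hP : Tendsto P (𝓝[>] 0) (𝓝 0) := by
    have hc : Continuous P := by fun_prop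
    have h00 : P 0 = 0 := by ext i; fin_cases i <;> simp [P]
    exact h00 ▸ hc.continuousWithinAt
  have hV : Tendsto V (𝓝[>] 0) (𝓝 a) := by
    have hc : Continuous V := by fun_prop
    have h00 : V 0 = a := by simp [V]
    exact (h00 ▸ hc.continuousWithinAt : Tendsto V (𝓝[>] 0) (𝓝 a))
  have hane : a ≠ 0 := by
    rintro rfl
    simp at ha
  have hnV : Tendsto (fun t => ‖V t‖⁻¹ • V t) (𝓝[>] 0) (𝓝 a) := by
    simpa [ha] using (hV.norm.inv₀ (norm_ne_zero_iff.2 hane)).smul hV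
  refine mem_closure_of_tendsto (hP.prodMk_nhds hnV) ?_
  filter_upwards [hV.eventually_ne hane, self_mem_nhdsWithin] with t hVt ht
  replace ht : t ≠ 0 := ne_of_gt ht
  let γ : ℝ → EuclideanSpace ℝ (Fin 3) := fun s =>
    !₂[(t + a 2 * s) ^ 2 * Real.cos (θ + r / t ^ 2 * s),
      (t + a 2 * s) ^ 2 * Real.sin (θ + r / t ^ 2 * s), t + a 2 * s]
  have hγ : HasDerivAt γ (V t) 0 := by
    have hz : HasDerivAt (fun s => t + a 2 * s) (a 2) 0 := by
      simpa using ((hasDerivAt_id (0 : ℝ)).const_mul (a 2)).const_add t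
    have hang : HasDerivAt (fun s => θ + r / t ^ 2 * s) (r / t ^ 2) 0 := by
      simpa using ((hasDerivAt_id (0 : ℝ)).const_mul (r / t ^ 2)).const_add θ
    rw [hasDerivAt_iff_hasFDerivAt, ← hasFDerivWithinAt_univ, hasFDerivWithinAt_euclidean]
    intro i
    rw [hasFDerivWithinAt_univ, hasFDerivAt_iff_hasDerivAt]
    fin_cases i
    · refine ((hz.pow 2).mul hang.cos).congr_deriv ?_
      simp [V, h0]
      field_simp
      ring
    · refine ((hz.pow 2).mul hang.sin).congr_deriv ?_
      simp [V, h1]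
      field_simp
      ring
    · simpa [γ, V] using hz
  have hγ0 : γ 0 = P t := by simp [γ, P]
  refine hγ0 ▸ mem_dirBundle_of_hasDerivAt hγ hVt fun s => ?_
  simp only [γ, Set.mem_ofPred_eq, Matrix.cons_val]
  linear_combination (t + a 2 * s) ^ 4 * Real.cos_sq_add_sin_sq (θ + r / t ^ 2 * s)

/-- For A₀ = {x² + y² = z⁴} ⊆ ℝ³, LGD(A₀) = ℝ³; in particular GD is stabilised at
degree 1 for A₀. -/
theorem stmt_9 (A : Set (EuclideanSpace ℝ (Fin 3)))
    (hA : A = {v | (v 0) ^ 2 + (v 1) ^ 2 = (v 2) ^ 4}) :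
    LGD A = Set.univ := by
  subst hA
  refine Set.eq_univ_of_forall fun x => ?_
  obtain rfl | hx := eq_or_ne x 0
  · exact ⟨0, le_rfl, EuclideanSpace.single 0 1, mem_GD_of_norm_eq_one (by simp), by simp⟩
  · have hx' : ‖x‖ ≠ 0 := norm_ne_zero_iff.2 hx
    refine ⟨‖x‖, norm_nonneg x, ‖x‖⁻¹ • x, mem_GD_of_norm_eq_one ?_, ?_⟩
    · rw [norm_smul, norm_inv, norm_norm, inv_mul_cancel₀ hx']
    · rw [smul_inv_smul₀ hx']
end

section
/- Let A = {(x,y,z,u,v,w) ∈ ℝ⁶ : x² + y² = z⁴ and u² + v² = w⁴}, the product of two copies of the surface {x² + y² = z⁴} ⊆ ℝ³. Then LGD(A) = ℝ⁶; in particular GD is stabilised at degree 1 for A. -/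
open Filter Topology Metric Set

/-- The normalised velocity of a curve in `A` is a direction of `A` at its base point. -/
theorem normalize_mem_dirSet_of_hasDerivAt {n : ℕ} {A : Set (EuclideanSpace ℝ (Fin n))}
    {γ : ℝ → EuclideanSpace ℝ (Fin n)} {d : EuclideanSpace ℝ (Fin n)}
    (hγ : HasDerivAt γ d 0) (hd : d ≠ 0) (hA : ∀ t, γ t ∈ A) :
    ‖d‖⁻¹ • d ∈ dirSet A (γ 0) := by
  have hs : Tendsto (slope γ 0) (𝓝[>] 0) (𝓝 d) :=
    (hasDerivAt_iff_tendsto_slope.1 hγ).mono_left (nhdsWithin_mono _ fun _ h => ne_of_gt h)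
  have hev : ∀ᶠ t in 𝓝[>] (0 : ℝ), 0 < t ∧ γ t ≠ γ 0 := by
    filter_upwards [hs.eventually_ne hd, self_mem_nhdsWithin] with t ht ht0
    refine ⟨ht0, fun h => ht ?_⟩
    simp [slope, h]
  obtain ⟨u, hu, hp⟩ := exists_seq_forall_of_frequently hev.frequently
  refine ⟨norm_smul_inv_norm (𝕜 := ℝ) hd, fun i => γ (u i), fun i => ⟨hA _, (hp i).2⟩,
    hγ.continuousAt.tendsto.comp (hu.mono_right nhdsWithin_le_nhds), ?_⟩
  have hsu := hs.comp hu
  refine ((hsu.norm.inv₀ (norm_ne_zero_iff.2 hd)).smul hsu).congr fun i => ?_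
  have hi := (hp i).1
  simp only [Function.comp, slope, vsub_eq_sub, sub_zero, norm_smul, norm_inv, Real.norm_eq_abs,
    abs_of_pos hi, smul_smul, mul_inv, inv_inv]
  congr 1
  field_simp

/-- Every plane vector is a multiple of a unit tangent vector to the unit circle. -/
theorem exists_eq_mul_neg_sin_cos (a b : ℝ) :
    ∃ r θ : ℝ, a = -(r * Real.sin θ) ∧ b = r * Real.cos θ := by
  refine ⟨‖(⟨b, -a⟩ : ℂ)‖, Complex.arg ⟨b, -a⟩, ?_, ?_⟩
  · rw [Complex.norm_mul_sin_arg]; simp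
  · rw [Complex.norm_mul_cos_arg]

/-- For `ε ≠ 0`, `t ↦ ((ε + c t)² e^{i (θ + r t / ε²)}, ε + c t)` runs in the surface
`x² + y² = z⁴`; this is the corresponding curve in the product of two such surfaces. -/
noncomputable def surfaceCurve (r θ c s φ e ε t : ℝ) : EuclideanSpace ℝ (Fin 6) :=
  !₂[(ε + c * t) ^ 2 * Real.cos (θ + r / ε ^ 2 * t),
    (ε + c * t) ^ 2 * Real.sin (θ + r / ε ^ 2 * t), ε + c * t,
    (ε + e * t) ^ 2 * Real.cos (φ + s / ε ^ 2 * t),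
    (ε + e * t) ^ 2 * Real.sin (φ + s / ε ^ 2 * t), ε + e * t]

/-- The velocity of `surfaceCurve` at time `0`. -/
noncomputable def surfaceVelocity (r θ c s φ e ε : ℝ) : EuclideanSpace ℝ (Fin 6) :=
  !₂[2 * ε * c * Real.cos θ - r * Real.sin θ, 2 * ε * c * Real.sin θ + r * Real.cos θ, c,
    2 * ε * e * Real.cos φ - s * Real.sin φ, 2 * ε * e * Real.sin φ + s * Real.cos φ, e]

theorem hasDerivAt_sq_mul_cos {r θ c ε : ℝ} (hε : ε ≠ 0) :
    HasDerivAt (fun t : ℝ => (ε + c * t) ^ 2 * Real.cos (θ + r / ε ^ 2 * t))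
      (2 * ε * c * Real.cos θ - r * Real.sin θ) 0 := by
  have h1 : HasDerivAt (fun t : ℝ => ε + c * t) c 0 := by
    simpa using ((hasDerivAt_id (0 : ℝ)).const_mul c).const_add ε
  have h2 : HasDerivAt (fun t : ℝ => θ + r / ε ^ 2 * t) (r / ε ^ 2) 0 := by
    simpa using ((hasDerivAt_id (0 : ℝ)).const_mul (r / ε ^ 2)).const_add θ
  refine ((h1.fun_pow 2).fun_mul h2.cos).congr_deriv ?_
  simp
  field_simp
  ring

theorem hasDerivAt_sq_mul_sin {r θ c ε : ℝ} (hε : ε ≠ 0) :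
    HasDerivAt (fun t : ℝ => (ε + c * t) ^ 2 * Real.sin (θ + r / ε ^ 2 * t))
      (2 * ε * c * Real.sin θ + r * Real.cos θ) 0 := by
  have h1 : HasDerivAt (fun t : ℝ => ε + c * t) c 0 := by
    simpa using ((hasDerivAt_id (0 : ℝ)).const_mul c).const_add ε
  have h2 : HasDerivAt (fun t : ℝ => θ + r / ε ^ 2 * t) (r / ε ^ 2) 0 := by
    simpa using ((hasDerivAt_id (0 : ℝ)).const_mul (r / ε ^ 2)).const_add θ
  refine ((h1.fun_pow 2).fun_mul h2.sin).congr_deriv ?_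
  simp
  field_simp

theorem hasDerivAt_surfaceCurve (r θ c s φ e : ℝ) {ε : ℝ} (hε : ε ≠ 0) :
    HasDerivAt (surfaceCurve r θ c s φ e ε) (surfaceVelocity r θ c s φ e ε) 0 := by
  have hlin (k : ℝ) : HasDerivAt (fun t : ℝ => ε + k * t) k 0 := by
    simpa using ((hasDerivAt_id (0 : ℝ)).const_mul k).const_add ε
  suffices h : HasDerivAt (fun t i => surfaceCurve r θ c s φ e ε t i)
      (fun i => surfaceVelocity r θ c s φ e ε i) 0 from
    (PiLp.continuousLinearEquiv 2 ℝ fun _ : Fin 6 => ℝ).symm.hasFDerivAt.comp_hasDerivAt 0 h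
  refine hasDerivAt_pi.2 fun i => ?_
  fin_cases i
  · exact hasDerivAt_sq_mul_cos hε
  · exact hasDerivAt_sq_mul_sin hε
  · exact hlin c
  · exact hasDerivAt_sq_mul_cos hε
  · exact hasDerivAt_sq_mul_sin hε
  · exact hlin e

theorem surfaceCurve_mem (r θ c s φ e ε t : ℝ) :
    surfaceCurve r θ c s φ e ε t ∈ {v : EuclideanSpace ℝ (Fin 6) |
      (v 0) ^ 2 + (v 1) ^ 2 = (v 2) ^ 4 ∧ (v 3) ^ 2 + (v 4) ^ 2 = (v 5) ^ 4} := by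
  have key (x α : ℝ) : (x ^ 2 * Real.cos α) ^ 2 + (x ^ 2 * Real.sin α) ^ 2 = x ^ 4 := by
    linear_combination x ^ 4 * Real.sin_sq_add_cos_sq α
  exact ⟨key _ _, key _ _⟩

theorem normalize_mem_GD {v : EuclideanSpace ℝ (Fin 6)} (hv : v ≠ 0) :
    ‖v‖⁻¹ • v ∈ GD {v : EuclideanSpace ℝ (Fin 6) |
      (v 0) ^ 2 + (v 1) ^ 2 = (v 2) ^ 4 ∧ (v 3) ^ 2 + (v 4) ^ 2 = (v 5) ^ 4} := by
  obtain ⟨r, θ, h0, h1⟩ := exists_eq_mul_neg_sin_cos (v 0) (v 1)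
  obtain ⟨s, φ, h3, h4⟩ := exists_eq_mul_neg_sin_cos (v 3) (v 4)
  have hbase : Tendsto (fun ε => surfaceCurve r θ (v 2) s φ (v 5) ε 0) (𝓝[≠] 0) (𝓝 0) := by
    have hc : Continuous fun ε => surfaceCurve r θ (v 2) s φ (v 5) ε 0 := by
      simp only [surfaceCurve, mul_zero, add_zero]
      fun_prop
    have h := (hc.tendsto 0).mono_left (nhdsWithin_le_nhds (s := {0}ᶜ))
    convert h using 2
    ext i
    fin_cases i <;> simp [surfaceCurve]
  have hvel : Tendsto (surfaceVelocity r θ (v 2) s φ (v 5)) (𝓝[≠] 0) (𝓝 v) := by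
    have hc : Continuous (surfaceVelocity r θ (v 2) s φ (v 5)) := by
      unfold surfaceVelocity
      fun_prop
    have h := (hc.tendsto 0).mono_left (nhdsWithin_le_nhds (s := {0}ᶜ))
    convert h using 2
    ext i
    fin_cases i <;> simp [surfaceVelocity, h0, h1, h3, h4]
  refine mem_closure_of_tendsto
    (hbase.prodMk_nhds ((hvel.norm.inv₀ (norm_ne_zero_iff.2 hv)).smul hvel)) ?_
  filter_upwards [hvel.eventually_ne hv, self_mem_nhdsWithin] with ε hne hε
  exact ⟨surfaceCurve_mem .., normalize_mem_dirSet_of_hasDerivAt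
    (hasDerivAt_surfaceCurve r θ (v 2) s φ (v 5) hε) hne fun t => surfaceCurve_mem ..⟩

/-- For A = {x² + y² = z⁴ and u² + v² = w⁴} ⊆ ℝ⁶, LGD(A) = ℝ⁶; in particular GD is
stabilised at degree 1 for A. -/
theorem stmt_10 (A : Set (EuclideanSpace ℝ (Fin 6)))
    (hA : A = {v | (v 0) ^ 2 + (v 1) ^ 2 = (v 2) ^ 4 ∧ (v 3) ^ 2 + (v 4) ^ 2 = (v 5) ^ 4}) :
    LGD A = Set.univ := by
  subst hA
  refine eq_univ_of_forall fun v => ?_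
  rcases eq_or_ne v 0 with rfl | hv
  · have hw : (EuclideanSpace.single 0 1 : EuclideanSpace ℝ (Fin 6)) ≠ 0 := by simp
    exact ⟨0, le_rfl, _, normalize_mem_GD hw, (zero_smul ℝ _).symm⟩
  · exact ⟨‖v‖, norm_nonneg v, _, normalize_mem_GD hv,
      (smul_inv_smul₀ (norm_ne_zero_iff.2 hv) v).symm⟩
end
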